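/- Let H and K be real inner product spaces, let D : H → K be a linear map, let k ≥ 1, and let (u_j)_{j=1}^k and (v_j)_{j=1}^k be two orthonormal families in H such that: (a) ⟨u_j, v_j⟩ ≥ 0 for every j; (b) the vectors D u₁, …, D u_k are pairwise orthogonal in K and the vectors D v₁, …, D v_k are pairwise orthogonal in K; (c) ‖D v_j‖ ≤ ‖D u_j‖ for every j; and (d) whenever ‖D v_j‖ = ‖D u_j‖, the vector v_j lies in the span of u₁, …, u_j. Then the vectors u_j + v_j, j = 1, …, k, are linearly independent. -/

import Mathlib

open scoped RealInnerProductSpace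

/-- Pythagoras for a linear combination of finitely many pairwise orthogonal vectors. -/
lemma norm_sq_sum_smul_of_pairwise_inner_eq_zero {ι E : Type*} [Fintype ι]
    [NormedAddCommGroup E] [InnerProductSpace ℝ E] (w : ι → E)
    (hw : ∀ i j, i ≠ j → ⟪w i, w j⟫ = 0) (c : ι → ℝ) :
    ‖∑ i, c i • w i‖ ^ 2 = ∑ i, c i ^ 2 * ‖w i‖ ^ 2 := by
  rw [← real_inner_self_eq_norm_sq, sum_inner]
  refine Finset.sum_congr rfl fun i _ => ?_
  rw [inner_sum, Finset.sum_eq_single i]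
  · rw [real_inner_smul_left, real_inner_smul_right, real_inner_self_eq_norm_sq]
    ring
  · intro j _ hj
    rw [real_inner_smul_left, real_inner_smul_right, hw i j hj.symm]
    simp
  · simp

/-- A member of an orthonormal family is orthogonal to the span of members with other indices. -/
lemma Orthonormal.inner_eq_zero_of_mem_span_image {ι E : Type*}
    [NormedAddCommGroup E] [InnerProductSpace ℝ E] {u : ι → E} (hu : Orthonormal ℝ u)
    {s : Set ι} {j : ι} (hj : j ∉ s) {x : E} (hx : x ∈ Submodule.span ℝ (u '' s)) :
    ⟪u j, x⟫ = 0 := by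
  induction hx using Submodule.span_induction with
  | mem x hx =>
    obtain ⟨i, hi, rfl⟩ := hx
    exact hu.2 fun h => hj (h ▸ hi)
  | zero => exact inner_zero_right _
  | add x y _ _ hx hy => rw [inner_add_right, hx, hy, add_zero]
  | smul a x _ hx => rw [real_inner_smul_right, hx, mul_zero]

/-- Abstract form of the paper's linear independence argument for the trial functions
`f_j = f_j^D + f_j^N` in the case `α = 1`: given a linear map `D : H → K` between real inner
product spaces and orthonormal families `(u_j)`, `(v_j)` in `H` such that `⟨u_j, v_j⟩ ≥ 0`,
the images `D u_j` (resp. `D v_j`) are pairwise orthogonal, `‖D v_j‖ ≤ ‖D u_j‖`, and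
`v_j ∈ span(u_1, …, u_j)` whenever `‖D v_j‖ = ‖D u_j‖`, the vectors `u_j + v_j` are
linearly independent. -/
theorem trial_functions_linearIndependent_of_eq_one
    {H K : Type*} [NormedAddCommGroup H] [InnerProductSpace ℝ H]
    [NormedAddCommGroup K] [InnerProductSpace ℝ K]
    (D : H →ₗ[ℝ] K) (k : ℕ) (hk : 1 ≤ k) (u v : Fin k → H)
    (hu : Orthonormal ℝ u) (hv : Orthonormal ℝ v)
    (ha : ∀ j, 0 ≤ ⟪u j, v j⟫)
    (hbu : ∀ i j, i ≠ j → ⟪D (u i), D (u j)⟫ = 0)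
    (hbv : ∀ i j, i ≠ j → ⟪D (v i), D (v j)⟫ = 0)
    (hc : ∀ j, ‖D (v j)‖ ≤ ‖D (u j)‖)
    (hd : ∀ j, ‖D (v j)‖ = ‖D (u j)‖ →
      v j ∈ Submodule.span ℝ (u '' {i | i ≤ j})) :
    LinearIndependent ℝ (fun j => u j + v j) := by
  classical
  rw [Fintype.linearIndependent_iff]
  intro c hsum
  have hsplit : ∑ i, c i • u i = -∑ i, c i • v i := by
    rw [eq_neg_iff_add_eq_zero, ← Finset.sum_add_distrib, ← hsum]
    simp only [smul_add]
  have henergy : ∑ i, c i ^ 2 * ‖D (v i)‖ ^ 2 = ∑ i, c i ^ 2 * ‖D (u i)‖ ^ 2 := by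
    rw [← norm_sq_sum_smul_of_pairwise_inner_eq_zero (fun i => D (u i)) hbu c,
      ← norm_sq_sum_smul_of_pairwise_inner_eq_zero (fun i => D (v i)) hbv c]
    have h := congrArg (fun x => ‖D x‖ ^ 2) hsplit
    simp only [map_neg, norm_neg, map_sum, map_smul] at h
    exact h.symm
  have hterm := (Finset.sum_eq_sum_iff_of_le (s := Finset.univ) fun i _ =>
    mul_le_mul_of_nonneg_left (pow_le_pow_left₀ (norm_nonneg _) (hc i) 2)
      (sq_nonneg (c i))).1 henergy
  have hmem : ∀ i, c i ≠ 0 → v i ∈ Submodule.span ℝ (u '' {l | l ≤ i}) := by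
    intro i hi
    have h := mul_left_cancel₀ (pow_ne_zero 2 hi) (hterm i (Finset.mem_univ i))
    exact hd i ((pow_left_inj₀ (norm_nonneg _) (norm_nonneg _) two_ne_zero).1 h)
  by_contra! hne
  obtain ⟨i₀, hi₀⟩ := hne
  obtain ⟨j, hj, hmax⟩ := Finset.exists_max_image (Finset.univ.filter fun i => c i ≠ 0) id
    ⟨i₀, by simpa using hi₀⟩
  have hcj : c j ≠ 0 := by simpa using hj
  have hinner : ⟪u j, ∑ i, c i • (u i + v i)⟫ = c j * (1 + ⟪u j, v j⟫) := by
    rw [inner_sum, Finset.sum_eq_single j]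
    · rw [real_inner_smul_right, inner_add_right, real_inner_self_eq_norm_sq, hu.1 j, one_pow]
    · intro i _ hij
      rw [real_inner_smul_right]
      by_cases hci : c i = 0
      · rw [hci, zero_mul]
      · have hle : i ≤ j := hmax i (by simpa using hci)
        rw [inner_add_right, hu.2 hij.symm, hu.inner_eq_zero_of_mem_span_image
          (fun h : j ≤ i => hij (le_antisymm hle h)) (hmem i hci), add_zero, mul_zero]
    · simp
  rw [hsum, inner_zero_right] at hinner
  rcases mul_eq_zero.1 hinner.symm with h | h
  · exact hcj h
  · linarith [ha j]
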